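/- For any formulas A and B, the inversion rules (li): from Γ,A→B ⇒ Δ infer Γ,B ⇒ Δ; (ri): from Γ,A→B ⇒ Δ infer Γ ⇒ A,Δ; (i→): from Γ ⇒ A→B,Δ infer Γ,A ⇒ B,Δ; and (i⊥): from Γ ⇒ ⊥,Δ infer Γ ⇒ Δ, are each strongly admissible in Go_∞+cut: for each rule there exists a non-expansive adequate mapping u : P → P taking any ∞-proof of the premise to an ∞-proof of the conclusion with |u(π)| ≤ |π| for every π ∈ P. -/

import Mathlib

inductive Formula : Type
  | atom : ℕ → Formula
  | bot  : Formula
  | imp  : Formula → Formula → Formula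
  | box  : Formula → Formula
deriving DecidableEq

def boxtimes (Γ : Multiset Formula) : Multiset Formula := Γ + Γ.map Formula.box

inductive GoSeq : Bool → Multiset Formula → Multiset Formula → Prop
  | ax (c) (Γ Δ : Multiset Formula) (A : Formula) : GoSeq c (A ::ₘ Γ) (A ::ₘ Δ)
  | axBot (c) (Γ Δ : Multiset Formula) : GoSeq c (Formula.bot ::ₘ Γ) Δ
  | impL (c) (Γ Δ : Multiset Formula) (A B : Formula) :
      GoSeq c (B ::ₘ Γ) Δ → GoSeq c Γ (A ::ₘ Δ) → GoSeq c ((A.imp B) ::ₘ Γ) Δ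
  | impR (c) (Γ Δ : Multiset Formula) (A B : Formula) :
      GoSeq c (A ::ₘ Γ) (B ::ₘ Δ) → GoSeq c Γ ((A.imp B) ::ₘ Δ)
  | boxGo (c) (Γ Δ Θ : Multiset Formula) (A : Formula) :
      GoSeq c ((Formula.box (A.imp (Formula.box A))) ::ₘ boxtimes Θ) {A} →
      GoSeq c (Γ + Θ.map Formula.box) ((Formula.box A) ::ₘ Δ)
  | cut (Γ Δ : Multiset Formula) (A : Formula) :
      GoSeq true Γ (A ::ₘ Δ) → GoSeq true (A ::ₘ Γ) Δ → GoSeq true Γ Δ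

inductive Frag : Bool → ℕ → Multiset Formula → Multiset Formula → Type
  | hole (c) (Γ Δ : Multiset Formula) : Frag c 0 Γ Δ
  | axP (c) (n) (Γ Δ : Multiset Formula) (p : ℕ) :
      Frag c (n+1) (Formula.atom p ::ₘ Γ) (Formula.atom p ::ₘ Δ)
  | axBot (c) (n) (Γ Δ : Multiset Formula) : Frag c (n+1) (Formula.bot ::ₘ Γ) Δ
  | impL (c) (n) (Γ Δ : Multiset Formula) (A B : Formula) :
      Frag c (n+1) (B ::ₘ Γ) Δ → Frag c (n+1) Γ (A ::ₘ Δ) →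
      Frag c (n+1) ((A.imp B) ::ₘ Γ) Δ
  | impR (c) (n) (Γ Δ : Multiset Formula) (A B : Formula) :
      Frag c (n+1) (A ::ₘ Γ) (B ::ₘ Δ) → Frag c (n+1) Γ ((A.imp B) ::ₘ Δ)
  | box (c) (n) (Γ Δ Θ : Multiset Formula) (l : List Formula) (h : l ≠ []) :
      Frag c (n+1) (boxtimes Θ) (boxtimes (↑l)) →
      ((i : Fin l.length) → Frag c n (boxtimes Θ) {l.get i}) →
      Frag c (n+1) (Γ + Θ.map Formula.box) ((↑(l.map Formula.box) : Multiset Formula) + Δ)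
  | cut (n) (Γ Δ : Multiset Formula) (A : Formula) :
      Frag true (n+1) Γ (A ::ₘ Δ) → Frag true (n+1) (A ::ₘ Γ) Δ → Frag true (n+1) Γ Δ

def Frag.trunc : ∀ {c : Bool} {n : ℕ} {Γ Δ : Multiset Formula}, Frag c (n+1) Γ Δ → Frag c n Γ Δ
  | c, 0, Γ, Δ, _ => .hole c Γ Δ
  | c, n+1, _, _, .axP _ _ Γ Δ p => .axP c n Γ Δ p
  | c, n+1, _, _, .axBot _ _ Γ Δ => .axBot c n Γ Δ
  | c, n+1, _, _, .impL _ _ Γ Δ A B a b => .impL c n Γ Δ A B a.trunc b.trunc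
  | c, n+1, _, _, .impR _ _ Γ Δ A B a => .impR c n Γ Δ A B a.trunc
  | c, n+1, _, _, .box _ _ Γ Δ Θ l h a bs => .box c n Γ Δ Θ l h a.trunc (fun i => (bs i).trunc)
  | _, n+1, _, _, .cut _ Γ Δ A a b => .cut n Γ Δ A a.trunc b.trunc

def Frag.height : ∀ {c : Bool} {n : ℕ} {Γ Δ : Multiset Formula}, Frag c n Γ Δ → ℕ
  | _, _, _, _, .hole _ _ _ => 0
  | _, _, _, _, .axP _ _ _ _ _ => 0
  | _, _, _, _, .axBot _ _ _ _ => 0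
  | _, _, _, _, .impL _ _ _ _ _ _ a b => max a.height b.height + 1
  | _, _, _, _, .impR _ _ _ _ _ _ a => a.height + 1
  | _, _, _, _, .box _ _ _ _ _ _ _ a bs =>
      max a.height (Finset.univ.sup fun i => (bs i).height) + 1
  | _, _, _, _, .cut _ _ _ _ a b => max a.height b.height + 1

def Frag.cutFree : ∀ {c : Bool} {n : ℕ} {Γ Δ : Multiset Formula}, Frag c n Γ Δ → Prop
  | _, _, _, _, .hole _ _ _ => True
  | _, _, _, _, .axP _ _ _ _ _ => True
  | _, _, _, _, .axBot _ _ _ _ => True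
  | _, _, _, _, .impL _ _ _ _ _ _ a b => a.cutFree ∧ b.cutFree
  | _, _, _, _, .impR _ _ _ _ _ _ a => a.cutFree
  | _, _, _, _, .box _ _ _ _ _ _ _ a bs => a.cutFree ∧ ∀ i, (bs i).cutFree
  | _, _, _, _, .cut _ _ _ _ _ _ => False

structure InfProof (c : Bool) (Γ Δ : Multiset Formula) : Type where
  frag : ∀ n : ℕ, Frag c n Γ Δ
  compat : ∀ n : ℕ, (frag (n+1)).trunc = frag n

structure PP : Type where
  Γ : Multiset Formula
  Δ : Multiset Formula
  prf : InfProof true Γ Δ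

def Sim : ℕ → PP → PP → Prop
  | 0, _, _ => True
  | n+1, π, τ => π.Γ = τ.Γ ∧ π.Δ = τ.Δ ∧ HEq (π.prf.frag (n+1)) (τ.prf.frag (n+1))

noncomputable def dP (π τ : PP) : ℝ :=
  sInf {r : ℝ | ∃ n : ℕ, Sim n π τ ∧ r = (1/2 : ℝ) ^ n}

def localHeight (π : PP) : ℕ := (π.prf.frag 1).height

def Pmem (n : ℕ) (π : PP) : Prop := (π.prf.frag n).cutFree

def IsUltrametric {M : Type*} (d : M → M → ℝ) : Prop :=
  (∀ x y, 0 ≤ d x y) ∧ (∀ x y, d x y = 0 ↔ x = y) ∧ (∀ x y, d x y = d y x) ∧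
  (∀ x y z, d x z ≤ max (d x y) (d y z))

def cBall {M : Type*} (d : M → M → ℝ) (x : M) (r : ℝ) : Set M := {y | d x y ≤ r}

def SphericallyComplete {M : Type*} (d : M → M → ℝ) : Prop :=
  ∀ (c : ℕ → M) (r : ℕ → ℝ), (∀ n, 0 ≤ r n) →
    (∀ n, cBall d (c (n+1)) (r (n+1)) ⊆ cBall d (c n) (r n)) →
    ∃ x, ∀ n, x ∈ cBall d (c n) (r n)

def NonExpansive1 (u : PP → PP) : Prop := ∀ π τ, dP (u π) (u τ) ≤ dP π τ

def Adequate1 (u : PP → PP) : Prop := ∀ n π, Pmem n π → Pmem n (u π)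

noncomputable def dPm {m : ℕ} (x y : Fin m → PP) : ℝ := ⨆ i, dP (x i) (y i)

def NonExpansiveM {m : ℕ} (u : (Fin m → PP) → PP) : Prop :=
  ∀ x y, dP (u x) (u y) ≤ dPm x y

def Fm (m : ℕ) : Type := {u : (Fin m → PP) → PP // NonExpansiveM u}

def SimF {m : ℕ} (n k : ℕ) (a b : (Fin m → PP) → PP) : Prop :=
  (∀ x, Sim n (a x) (b x)) ∧
  (∀ x, (∑ i, localHeight (x i)) < k → Sim (n+1) (a x) (b x))

noncomputable def lm {m : ℕ} (a b : (Fin m → PP) → PP) : ℝ :=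
  (1/2) * sInf {r : ℝ | ∃ n k : ℕ, SimF n k a b ∧ r = (1/2 : ℝ) ^ n + (1/2 : ℝ) ^ (n + k)}

noncomputable def dP2 (p q : PP × PP) : ℝ := max (dP p.1 q.1) (dP p.2 q.2)

def NonExpansive2 (u : PP × PP → PP) : Prop := ∀ p q, dP (u p) (u q) ≤ dP2 p q

def Adequate2 (u : PP × PP → PP) : Prop :=
  ∀ n π τ, Pmem n π → Pmem n τ → Pmem n (u (π, τ))

def Removing (A : Formula) (u : PP × PP → PP) : Prop :=
  ∀ (Γ Δ : Multiset Formula) (π τ : PP),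
    π.Γ = Γ → π.Δ = A ::ₘ Δ → τ.Γ = A ::ₘ Γ → τ.Δ = Δ →
    (u (π, τ)).Γ = Γ ∧ (u (π, τ)).Δ = Δ

def RA (A : Formula) : Type := {u : PP × PP → PP // NonExpansive2 u ∧ Removing A u}

def SimF2 (n k : ℕ) (a b : PP × PP → PP) : Prop :=
  (∀ p, Sim n (a p) (b p)) ∧
  (∀ p : PP × PP, localHeight p.1 + localHeight p.2 < k → Sim (n+1) (a p) (b p))

noncomputable def l2 (a b : PP × PP → PP) : ℝ :=
  (1/2) * sInf {r : ℝ | ∃ n k : ℕ, SimF2 n k a b ∧ r = (1/2 : ℝ) ^ n + (1/2 : ℝ) ^ (n + k)}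

namespace Frag

/-- Transport of a fragment along equalities of the antecedent and the succedent. -/
def copy {c : Bool} {n : ℕ} {Γ Δ Γ' Δ' : Multiset Formula} (hΓ : Γ = Γ') (hΔ : Δ = Δ')
    (f : Frag c n Γ Δ) : Frag c n Γ' Δ' :=
  hΔ ▸ hΓ ▸ f

section copy

variable {c : Bool} {n : ℕ} {Γ Δ Γ' Δ' : Multiset Formula} (hΓ : Γ = Γ') (hΔ : Δ = Δ')

@[simp]
theorem trunc_copy (f : Frag c (n + 1) Γ Δ) : (f.copy hΓ hΔ).trunc = f.trunc.copy hΓ hΔ := by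
  subst hΓ hΔ; rfl

@[simp]
theorem height_copy (f : Frag c n Γ Δ) : (f.copy hΓ hΔ).height = f.height := by
  subst hΓ hΔ; rfl

@[simp]
theorem cutFree_copy (f : Frag c n Γ Δ) : (f.copy hΓ hΔ).cutFree ↔ f.cutFree := by
  subst hΓ hΔ; rfl

end copy

instance (c : Bool) (Γ Δ : Multiset Formula) : Subsingleton (Frag c 0 Γ Δ) :=
  ⟨fun a b => by cases a; cases b; rfl⟩

end Frag

/-- An inversion rule: from `XL + Γ ⇒ XR + Δ` infer `YL + Γ ⇒ YR + Δ`, where the removed formulas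
`XL`, `XR` can be principal only in an implication rule one of whose premises is the conclusion of
the inversion. -/
structure InversionRule where
  XL : Multiset Formula
  XR : Multiset Formula
  YL : Multiset Formula
  YR : Multiset Formula
  atom_notMem_left : ∀ p, Formula.atom p ∉ XL
  atom_notMem_right : ∀ p, Formula.atom p ∉ XR
  bot_notMem_left : Formula.bot ∉ XL
  box_notMem_left : ∀ C, Formula.box C ∉ XL
  box_notMem_right : ∀ C, Formula.box C ∉ XR
  imp_left : ∀ C D, Formula.imp C D ∈ XL → XL = {C.imp D} ∧ XR = 0 ∧
    ((YL = {D} ∧ YR = 0) ∨ (YL = 0 ∧ YR = {C}))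
  imp_right : ∀ C D, Formula.imp C D ∈ XR → XL = 0 ∧ XR = {C.imp D} ∧ YL = {C} ∧ YR = {D}

section Multiset

variable {α : Type*} [DecidableEq α]

theorem Multiset.eq_cons_sub_of_cons_eq_add {a : α} {s t u : Multiset α} (ha : a ∉ t)
    (h : a ::ₘ s = t + u) : u = a ::ₘ (s - t) ∧ s = t + (s - t) := by
  have hu : a ∈ u := by
    have : a ∈ t + u := h ▸ Multiset.mem_cons_self a s
    simpa [ha] using this
  obtain ⟨v, rfl⟩ := Multiset.exists_cons_of_mem hu
  rw [Multiset.add_cons, Multiset.cons_inj_right] at h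
  subst h
  simp

theorem Multiset.eq_sub_add_of_add_eq_add {s t u w : Multiset α} (hw : ∀ a ∈ w, a ∉ t)
    (h : s + w = t + u) : u = s - t + w ∧ s = t + (s - t) := by
  have hle : t ≤ s := by
    rw [Multiset.le_iff_count]
    intro a
    have hc := congrArg (Multiset.count a) h
    simp only [Multiset.count_add] at hc
    by_cases ha : a ∈ w
    · simp [Multiset.count_eq_zero_of_notMem (hw a ha)]
    · rw [Multiset.count_eq_zero_of_notMem ha] at hc
      omega
  have hs : s = t + (s - t) := (add_tsub_cancel_of_le hle).symm
  refine ⟨?_, hs⟩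
  rw [hs, add_assoc] at h
  exact (add_left_cancel h).symm

end Multiset

namespace Frag

variable (R : InversionRule)

/-- The inversion of a fragment. -/
def invert : ∀ {c : Bool} {n : ℕ} {Γ Δ : Multiset Formula}, Frag c n Γ Δ →
    ∀ (Γ' Δ' : Multiset Formula), Γ = R.XL + Γ' → Δ = R.XR + Δ' →
      Frag c n (R.YL + Γ') (R.YR + Δ')
  | c, _, _, _, .hole _ _ _, Γ', Δ', _, _ => .hole c _ _
  | c, _, _, _, .axP _ n Γ Δ p, Γ', Δ', hΓ, hΔ =>
      (Frag.axP c n (R.YL + (Γ - R.XL)) (R.YR + (Δ - R.XR)) p).copy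
        (by rw [(Multiset.eq_cons_sub_of_cons_eq_add (R.atom_notMem_left p) hΓ).1,
          Multiset.add_cons])
        (by rw [(Multiset.eq_cons_sub_of_cons_eq_add (R.atom_notMem_right p) hΔ).1,
          Multiset.add_cons])
  | c, _, _, _, .axBot _ n Γ Δ, Γ', Δ', hΓ, _ =>
      (Frag.axBot c n (R.YL + (Γ - R.XL)) (R.YR + Δ')).copy
        (by rw [(Multiset.eq_cons_sub_of_cons_eq_add R.bot_notMem_left hΓ).1,
          Multiset.add_cons]) rfl
  | c, _, _, _, .impL _ n Γ Δ C D a b, Γ', Δ', hΓ, hΔ =>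
      if h : C.imp D ∈ R.XL then
        if hY : R.YL = {D} ∧ R.YR = 0 then
          a.copy
            (by
              rw [(R.imp_left C D h).1, Multiset.singleton_add, Multiset.cons_inj_right] at hΓ
              rw [hY.1, hΓ, Multiset.singleton_add])
            (by rw [hΔ, (R.imp_left C D h).2.1, hY.2])
        else
          b.copy
            (by
              rw [(R.imp_left C D h).1, Multiset.singleton_add, Multiset.cons_inj_right] at hΓ
              rw [((R.imp_left C D h).2.2.resolve_left hY).1, hΓ, zero_add])
            (by
              rw [hΔ, (R.imp_left C D h).2.1, ((R.imp_left C D h).2.2.resolve_left hY).2, zero_add,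
                Multiset.singleton_add])
      else
        have e := Multiset.eq_cons_sub_of_cons_eq_add h hΓ
        (Frag.impL c n (R.YL + (Γ - R.XL)) (R.YR + Δ') C D
          ((a.invert (D ::ₘ (Γ - R.XL)) Δ' (by rw [Multiset.add_cons, ← e.2]) hΔ).copy
            (Multiset.add_cons ..) rfl)
          ((b.invert (Γ - R.XL) (C ::ₘ Δ') e.2 (by rw [Multiset.add_cons, hΔ])).copy
            rfl (Multiset.add_cons ..))).copy
          (by rw [e.1, Multiset.add_cons]) rfl
  | c, _, _, _, .impR _ n Γ Δ C D a, Γ', Δ', hΓ, hΔ =>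
      if h : C.imp D ∈ R.XR then
        a.copy
          (by rw [hΓ, (R.imp_right C D h).1, (R.imp_right C D h).2.2.1, zero_add,
            Multiset.singleton_add])
          (by
            rw [(R.imp_right C D h).2.1, Multiset.singleton_add, Multiset.cons_inj_right] at hΔ
            rw [(R.imp_right C D h).2.2.2, hΔ, Multiset.singleton_add])
      else
        have e := Multiset.eq_cons_sub_of_cons_eq_add h hΔ
        (Frag.impR c n (R.YL + Γ') (R.YR + (Δ - R.XR)) C D
          ((a.invert (C ::ₘ Γ') (D ::ₘ (Δ - R.XR)) (by rw [Multiset.add_cons, hΓ])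
            (by rw [Multiset.add_cons, ← e.2])).copy
            (Multiset.add_cons ..) (Multiset.add_cons ..))).copy
          rfl (by rw [e.1, Multiset.add_cons])
  | c, _, _, _, .box _ n Γ Δ Θ l h a bs, Γ', Δ', hΓ, hΔ =>
      (Frag.box c n (R.YL + (Γ - R.XL)) (R.YR + (Δ - R.XR)) Θ l h a bs).copy
        (by
          rw [(Multiset.eq_sub_add_of_add_eq_add (w := Θ.map Formula.box) (by
            intro x hx
            obtain ⟨C, -, rfl⟩ := Multiset.mem_map.1 hx
            exact R.box_notMem_left C) hΓ).1, add_assoc])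
        (by
          rw [add_comm] at hΔ
          rw [(Multiset.eq_sub_add_of_add_eq_add
            (w := (↑(l.map Formula.box) : Multiset Formula)) (by
            intro x hx
            obtain ⟨C, -, rfl⟩ := List.mem_map.1 (Multiset.mem_coe.1 hx)
            exact R.box_notMem_right C) hΔ).1, add_comm, add_assoc])
  | _, _, _, _, .cut n Γ Δ C a b, Γ', Δ', hΓ, hΔ =>
      Frag.cut n (R.YL + Γ') (R.YR + Δ') C
        ((a.invert Γ' (C ::ₘ Δ') hΓ (by rw [Multiset.add_cons, hΔ])).copy
          rfl (Multiset.add_cons ..))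
        ((b.invert (C ::ₘ Γ') Δ' (by rw [Multiset.add_cons, hΓ]) hΔ).copy
          (Multiset.add_cons ..) rfl)

theorem trunc_invert : ∀ {c : Bool} {n : ℕ} {Γ Δ : Multiset Formula} (f : Frag c (n + 1) Γ Δ)
    (Γ' Δ' : Multiset Formula) (hΓ : Γ = R.XL + Γ') (hΔ : Δ = R.XR + Δ'),
    (f.invert R Γ' Δ' hΓ hΔ).trunc = f.trunc.invert R Γ' Δ' hΓ hΔ
  | _, 0, _, _, _, _, _, _, _ => Subsingleton.elim _ _
  | _, _ + 1, _, _, .axP .., _, _, _, _ => by simp [invert, trunc]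
  | _, _ + 1, _, _, .axBot .., _, _, _, _ => by simp [invert, trunc]
  | _, _ + 1, _, _, .impL _ _ _ _ _ _ a b, _, _, _, _ => by
      simp only [invert, trunc]
      split_ifs <;> simp [trunc, trunc_invert a, trunc_invert b]
  | _, _ + 1, _, _, .impR _ _ _ _ _ _ a, _, _, _, _ => by
      simp only [invert, trunc]
      split_ifs <;> simp [trunc, trunc_invert a]
  | _, _ + 1, _, _, .box .., _, _, _, _ => by simp [invert, trunc]
  | _, _ + 1, _, _, .cut _ _ _ _ a b, _, _, _, _ => by
      simp [invert, trunc, trunc_invert a, trunc_invert b]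

theorem height_invert_le {c : Bool} {n : ℕ} {Γ Δ : Multiset Formula} (f : Frag c n Γ Δ)
    (Γ' Δ' : Multiset Formula) (hΓ : Γ = R.XL + Γ') (hΔ : Δ = R.XR + Δ') :
    (f.invert R Γ' Δ' hΓ hΔ).height ≤ f.height := by
  induction f generalizing Γ' Δ' with
  | hole => simp [invert, height]
  | axP => simp [invert, height]
  | axBot => simp [invert, height]
  | impL _ _ _ _ _ _ _ _ iha ihb =>
    simp only [invert]
    split_ifs
    · simp only [height_copy, height]; omega
    · simp only [height_copy, height]; omega
    · simp only [height_copy, height]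
      gcongr
      exacts [iha .., ihb ..]
  | impR _ _ _ _ _ _ _ iha =>
    simp only [invert]
    split_ifs
    · simp [height]
    · simp only [height_copy, height]
      gcongr
      exact iha ..
  | box => simp [invert, height]
  | cut _ _ _ _ _ _ iha ihb =>
    simp only [invert, height_copy, height]
    gcongr
    exacts [iha .., ihb ..]

theorem cutFree.invert {c : Bool} {n : ℕ} {Γ Δ : Multiset Formula} {f : Frag c n Γ Δ}
    (hf : f.cutFree) (Γ' Δ' : Multiset Formula) (hΓ : Γ = R.XL + Γ') (hΔ : Δ = R.XR + Δ') :
    (f.invert R Γ' Δ' hΓ hΔ).cutFree := by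
  induction f generalizing Γ' Δ' with
  | hole => simp [Frag.invert, cutFree]
  | axP => simp [Frag.invert, cutFree]
  | axBot => simp [Frag.invert, cutFree]
  | impL _ _ _ _ _ _ _ _ iha ihb =>
    simp only [cutFree] at hf
    simp only [Frag.invert]
    split_ifs
    · simpa using hf.1
    · simpa using hf.2
    · simpa [cutFree] using ⟨iha hf.1 .., ihb hf.2 ..⟩
  | impR _ _ _ _ _ _ _ iha =>
    simp only [cutFree] at hf
    simp only [Frag.invert]
    split_ifs
    · simpa using hf
    · simpa [cutFree] using iha hf ..
  | box => simpa [Frag.invert, cutFree] using hf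
  | cut => exact hf.elim

end Frag

theorem nonExpansive1_of_sim {u : PP → PP} (h : ∀ n π τ, Sim n π τ → Sim n (u π) (u τ)) :
    NonExpansive1 u := by
  intro π τ
  refine csInf_le_csInf ⟨0, ?_⟩ ⟨1, 0, trivial, by simp⟩ ?_
  · rintro r ⟨n, -, rfl⟩
    positivity
  · rintro r ⟨n, hn, rfl⟩
    exact ⟨n, h n π τ hn, rfl⟩

namespace InversionRule

variable (R : InversionRule)

/-- The mapping on `∞`-proofs induced by an inversion rule; proofs that do not end in a premise of
the rule are left unchanged. -/
def map (π : PP) : PP :=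
  if h : R.XL ≤ π.Γ ∧ R.XR ≤ π.Δ then
    { Γ := R.YL + (π.Γ - R.XL)
      Δ := R.YR + (π.Δ - R.XR)
      prf :=
        { frag := fun n => (π.prf.frag n).invert R _ _
            (add_tsub_cancel_of_le h.1).symm (add_tsub_cancel_of_le h.2).symm
          compat := fun n => by rw [Frag.trunc_invert, π.prf.compat] } }
  else π

theorem sim_map {n : ℕ} {π τ : PP} (h : Sim n π τ) : Sim n (R.map π) (R.map τ) := by
  cases n with
  | zero => trivial
  | succ n =>
    obtain ⟨Γ, Δ, p⟩ := π
    obtain ⟨Γ', Δ', q⟩ := τ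
    obtain ⟨rfl, rfl, h⟩ := h
    have h := eq_of_heq h
    unfold map
    dsimp only at h ⊢
    split_ifs
    · exact ⟨rfl, rfl, by simp only [h]; rfl⟩
    · exact ⟨rfl, rfl, heq_of_eq h⟩

theorem adequate1_map : Adequate1 R.map := by
  intro n π h
  unfold map
  split_ifs
  · exact Frag.cutFree.invert R h ..
  · exact h

theorem localHeight_map_le (π : PP) : localHeight (R.map π) ≤ localHeight π := by
  unfold map
  split_ifs
  · exact Frag.height_invert_le R ..
  · exact le_rfl

theorem map_spec {Γ Δ : Multiset Formula} {π : PP} (hΓ : π.Γ = R.XL + Γ) (hΔ : π.Δ = R.XR + Δ) :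
    (R.map π).Γ = R.YL + Γ ∧ (R.map π).Δ = R.YR + Δ := by
  simp [map, hΓ, hΔ]

/-- The inversion `Γ, A → B ⇒ Δ / Γ, B ⇒ Δ`. -/
def impLeft (A B : Formula) : InversionRule where
  XL := {A.imp B}
  XR := 0
  YL := {B}
  YR := 0
  atom_notMem_left := by simp
  atom_notMem_right := by simp
  bot_notMem_left := by simp
  box_notMem_left := by simp
  box_notMem_right := by simp
  imp_left := by simp_all
  imp_right := by simp

/-- The inversion `Γ, A → B ⇒ Δ / Γ ⇒ A, Δ`. -/
def impLeft' (A B : Formula) : InversionRule where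
  XL := {A.imp B}
  XR := 0
  YL := 0
  YR := {A}
  atom_notMem_left := by simp
  atom_notMem_right := by simp
  bot_notMem_left := by simp
  box_notMem_left := by simp
  box_notMem_right := by simp
  imp_left := by simp_all
  imp_right := by simp

/-- The inversion `Γ ⇒ A → B, Δ / Γ, A ⇒ B, Δ`. -/
def impRight (A B : Formula) : InversionRule where
  XL := 0
  XR := {A.imp B}
  YL := {A}
  YR := {B}
  atom_notMem_left := by simp
  atom_notMem_right := by simp
  bot_notMem_left := by simp
  box_notMem_left := by simp
  box_notMem_right := by simp
  imp_left := by simp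
  imp_right := by simp_all

/-- The inversion `Γ ⇒ ⊥, Δ / Γ ⇒ Δ`. -/
def botRight : InversionRule where
  XL := 0
  XR := {Formula.bot}
  YL := 0
  YR := 0
  atom_notMem_left := by simp
  atom_notMem_right := by simp
  bot_notMem_left := by simp
  box_notMem_left := by simp
  box_notMem_right := by simp
  imp_left := by simp
  imp_right := by simp

theorem nonExpansive1_map : NonExpansive1 R.map :=
  nonExpansive1_of_sim fun _ _ _ => R.sim_map

end InversionRule

theorem stmt14 (A B : Formula) :
    (∃ u : PP → PP, NonExpansive1 u ∧ Adequate1 u ∧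
      (∀ (Γ Δ : Multiset Formula) (π : PP), π.Γ = (A.imp B) ::ₘ Γ → π.Δ = Δ →
        (u π).Γ = B ::ₘ Γ ∧ (u π).Δ = Δ) ∧
      (∀ π : PP, localHeight (u π) ≤ localHeight π)) ∧
    (∃ u : PP → PP, NonExpansive1 u ∧ Adequate1 u ∧
      (∀ (Γ Δ : Multiset Formula) (π : PP), π.Γ = (A.imp B) ::ₘ Γ → π.Δ = Δ →
        (u π).Γ = Γ ∧ (u π).Δ = A ::ₘ Δ) ∧
      (∀ π : PP, localHeight (u π) ≤ localHeight π)) ∧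
    (∃ u : PP → PP, NonExpansive1 u ∧ Adequate1 u ∧
      (∀ (Γ Δ : Multiset Formula) (π : PP), π.Γ = Γ → π.Δ = (A.imp B) ::ₘ Δ →
        (u π).Γ = A ::ₘ Γ ∧ (u π).Δ = B ::ₘ Δ) ∧
      (∀ π : PP, localHeight (u π) ≤ localHeight π)) ∧
    (∃ u : PP → PP, NonExpansive1 u ∧ Adequate1 u ∧
      (∀ (Γ Δ : Multiset Formula) (π : PP), π.Γ = Γ → π.Δ = Formula.bot ::ₘ Δ →
        (u π).Γ = Γ ∧ (u π).Δ = Δ) ∧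
      (∀ π : PP, localHeight (u π) ≤ localHeight π)) := by
  refine ⟨⟨(InversionRule.impLeft A B).map, InversionRule.nonExpansive1_map _,
      InversionRule.adequate1_map _, fun Γ Δ π hΓ hΔ => ?_, InversionRule.localHeight_map_le _⟩,
    ⟨(InversionRule.impLeft' A B).map, InversionRule.nonExpansive1_map _,
      InversionRule.adequate1_map _, fun Γ Δ π hΓ hΔ => ?_, InversionRule.localHeight_map_le _⟩,
    ⟨(InversionRule.impRight A B).map, InversionRule.nonExpansive1_map _,
      InversionRule.adequate1_map _, fun Γ Δ π hΓ hΔ => ?_, InversionRule.localHeight_map_le _⟩,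
    ⟨InversionRule.botRight.map, InversionRule.nonExpansive1_map _,
      InversionRule.adequate1_map _, fun Γ Δ π hΓ hΔ => ?_, InversionRule.localHeight_map_le _⟩⟩
  · simpa [InversionRule.impLeft] using (InversionRule.impLeft A B).map_spec (Γ := Γ) (Δ := Δ)
      (by simpa [InversionRule.impLeft] using hΓ) (by simpa [InversionRule.impLeft] using hΔ)
  · simpa [InversionRule.impLeft'] using (InversionRule.impLeft' A B).map_spec (Γ := Γ) (Δ := Δ)
      (by simpa [InversionRule.impLeft'] using hΓ) (by simpa [InversionRule.impLeft'] using hΔ)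
  · simpa [InversionRule.impRight] using (InversionRule.impRight A B).map_spec (Γ := Γ) (Δ := Δ)
      (by simpa [InversionRule.impRight] using hΓ) (by simpa [InversionRule.impRight] using hΔ)
  · simpa [InversionRule.botRight] using InversionRule.botRight.map_spec (Γ := Γ) (Δ := Δ)
      (by simpa [InversionRule.botRight] using hΓ) (by simpa [InversionRule.botRight] using hΔ)
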